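/- Let k ∈ ℂ and φ : ℝ>0 × ℝ≥0 → V a smooth function satisfying the cocycle relation (C_k). Then there exist a smooth function ψ : ℝ≥0 → V and c ∈ V such that φ(λ, t) = λ^{-k} ψ(λt) − ψ(t) + t^k log(λ) c for all λ > 0, t ≥ 0; moreover c = 0 unless k ∈ ℤ≥0. -/

import Mathlib

open Set

section WeightedDilation

variable {V : Type*} [NormedAddCommGroup V] [NormedSpace ℂ V]

lemma intervalIntegrable_cpow_smul_comp_mul {g : ℝ → V} (hg : ContinuousOn g (Ici 0)) {a : ℂ}
    (ha : -1 < a.re) {t : ℝ} (ht : 0 ≤ t) :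
    IntervalIntegrable (fun u : ℝ => (u : ℂ) ^ a • g (t * u)) MeasureTheory.volume 0 1 := by
  refine (intervalIntegral.intervalIntegrable_cpow' ha).smul_continuousOn ?_
  refine hg.comp (by fun_prop) fun u hu => ?_
  rw [uIcc_of_le zero_le_one] at hu
  exact mul_nonneg ht hu.1

lemma hasDerivWithinAt_comp_mul_left {f : ℝ → V} (hf : ContDiffOn ℝ 1 f (Ici 0)) {t u : ℝ}
    (ht : 0 ≤ t) (hu : 0 ≤ u) :
    HasDerivWithinAt (fun v => f (t * v)) ((t : ℂ) • derivWithin f (Ici 0) (t * u)) (Ici 0) u := by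
  have hfu := (hf.differentiableOn one_ne_zero _
    (show t * u ∈ Ici 0 from mul_nonneg ht hu)).hasDerivWithinAt
  have hsc := hfu.scomp (s := Ici 0) u (((hasDerivAt_id u).const_mul t).hasDerivWithinAt)
    fun v hv => mul_nonneg ht hv
  rwa [mul_one, ← Complex.coe_smul t] at hsc

lemma hasDerivAt_integral_cpow_smul_comp_mul {g g' : ℝ → V} (hg' : Continuous g')
    (hg : ∀ x, HasDerivAt g (g' x) x) {a : ℂ} (ha : -1 < a.re) (t : ℝ) :
    HasDerivAt (fun x : ℝ => ∫ u in (0 : ℝ)..1, (u : ℂ) ^ a • g (x * u))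
      (∫ u in (0 : ℝ)..1, (u : ℂ) ^ (a + 1) • g' (t * u)) t := by
  have hgc : Continuous g := continuous_iff_continuousAt.2 fun x => (hg x).continuousAt
  have ha' : -1 < (a + 1).re := by simp; linarith
  have hint (b : ℂ) (hb : -1 < b.re) (h : ℝ → V) (hh : Continuous h) (x : ℝ) :
      IntervalIntegrable (fun u : ℝ => (u : ℂ) ^ b • h (x * u)) MeasureTheory.volume 0 1 :=
    (intervalIntegral.intervalIntegrable_cpow' hb).smul_continuousOn (by fun_prop)
  obtain ⟨C, hC⟩ := (isCompact_Icc (a := -(|t| + 1)) (b := |t| + 1)).exists_bound_of_continuousOn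
    hg'.continuousOn
  refine (intervalIntegral.hasDerivAt_integral_of_dominated_loc_of_deriv_le
    (F' := fun (x : ℝ) (u : ℝ) => (u : ℂ) ^ (a + 1) • g' (x * u))
    (bound := fun u : ℝ => ‖(u : ℂ) ^ (a + 1)‖ * C)
    (Metric.ball_mem_nhds t one_pos)
    (.of_forall fun x => (hint a ha g hgc x).def'.aestronglyMeasurable)
    (hint a ha g hgc t) (hint _ ha' g' hg' t).def'.aestronglyMeasurable
    (.of_forall fun u hu x hx => ?_)
    ((intervalIntegral.intervalIntegrable_cpow' ha').norm.mul_const C)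
    (.of_forall fun u hu x _ => ?_)).2
  · rw [uIoc_of_le zero_le_one] at hu
    rw [norm_smul]
    refine mul_le_mul_of_nonneg_left (hC _ (abs_le.1 ?_)) (norm_nonneg _)
    have hx' : |x| ≤ |t| + 1 := by
      have := abs_sub_abs_le_abs_sub x t
      rw [Metric.mem_ball, Real.dist_eq] at hx
      linarith
    rw [abs_mul, abs_of_pos hu.1]
    exact (mul_le_of_le_one_right (abs_nonneg x) hu.2).trans hx'
  · rw [uIoc_of_le zero_le_one] at hu
    have h := ((hg (x * u)).scomp x ((hasDerivAt_id x).mul_const u)).const_smul ((u : ℂ) ^ a)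
    refine h.congr_deriv ?_
    rw [Complex.cpow_add _ _ (Complex.ofReal_ne_zero.2 hu.1.ne'), Complex.cpow_one, one_mul,
      mul_smul, Complex.coe_smul]

variable [CompleteSpace V]

lemma exists_hasDerivAt_extension_of_contDiffOn_Ici {f : ℝ → V}
    (hf : ContDiffOn ℝ 1 f (Ici 0)) :
    ∃ g g' : ℝ → V, Continuous g' ∧ (∀ x, HasDerivAt g (g' x) x) ∧
      (∀ x, 0 ≤ x → g x = f x) ∧ ∀ x, 0 ≤ x → g' x = derivWithin f (Ici 0) x := by
  have hd : ContinuousOn (derivWithin f (Ici 0)) (Ici 0) :=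
    hf.continuousOn_derivWithin (uniqueDiffOn_Ici 0) le_rfl
  let g' : ℝ → V := fun x => derivWithin f (Ici 0) (max x 0)
  have hg' : Continuous g' :=
    hd.comp_continuous (by fun_prop) fun x => le_max_right x 0
  refine ⟨fun x => f 0 + ∫ s in (0 : ℝ)..x, g' s, g', hg', fun x => ?_, fun x hx => ?_,
    fun x hx => by simp [g', hx]⟩
  · exact (hg'.integral_hasStrictDerivAt 0 x).hasDerivAt.const_add _
  · have := intervalIntegral.integral_eq_sub_of_hasDeriv_right_of_le (f := f) (f' := g') hx
      (hf.continuousOn.mono Icc_subset_Ici_self) (fun y hy => ?_) (hg'.intervalIntegrable _ _)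
    · simp [this]
    · have hy0 : 0 ≤ y := hy.1.le
      have := ((hf.differentiableOn one_ne_zero) y hy0).hasDerivWithinAt
      rw [show g' y = derivWithin f (Ici 0) y by simp [g', hy0]]
      exact this.mono fun z hz => hy0.trans (le_of_lt hz)

lemma hasDerivWithinAt_integral_cpow_smul_comp_mul {f : ℝ → V} (hf : ContDiffOn ℝ 1 f (Ici 0))
    {a : ℂ} (ha : -1 < a.re) {t : ℝ} (ht : 0 ≤ t) :
    HasDerivWithinAt (fun x : ℝ => ∫ u in (0 : ℝ)..1, (u : ℂ) ^ a • f (x * u))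
      (∫ u in (0 : ℝ)..1, (u : ℂ) ^ (a + 1) • derivWithin f (Ici 0) (t * u)) (Ici 0) t := by
  obtain ⟨g, g', hg', hg, hgf, hgf'⟩ := exists_hasDerivAt_extension_of_contDiffOn_Ici hf
  have hcongr {b : ℂ} {h₁ h₂ : ℝ → V} (h : ∀ x, 0 ≤ x → h₁ x = h₂ x) {x : ℝ} (hx : 0 ≤ x) :
      ∫ u in (0 : ℝ)..1, (u : ℂ) ^ b • h₁ (x * u) =
        ∫ u in (0 : ℝ)..1, (u : ℂ) ^ b • h₂ (x * u) := by
    refine intervalIntegral.integral_congr fun u hu => ?_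
    rw [uIcc_of_le zero_le_one] at hu
    simp only [h _ (mul_nonneg hx hu.1)]
  rw [← hcongr hgf' ht]
  exact (hasDerivAt_integral_cpow_smul_comp_mul hg' hg ha t).hasDerivWithinAt.congr
    (fun x hx => (hcongr hgf hx).symm) (hcongr hgf ht).symm

lemma contDiffOn_integral_cpow_smul_comp_mul {f : ℝ → V} (hf : ContDiffOn ℝ (⊤ : ℕ∞) f (Ici 0))
    {a : ℂ} (ha : -1 < a.re) :
    ContDiffOn ℝ (⊤ : ℕ∞) (fun x : ℝ => ∫ u in (0 : ℝ)..1, (u : ℂ) ^ a • f (x * u)) (Ici 0) := by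
  refine contDiffOn_infty.2 fun n => ?_
  induction n generalizing f a with
  | zero =>
    exact contDiffOn_zero.2 fun t ht =>
      (hasDerivWithinAt_integral_cpow_smul_comp_mul (hf.of_le (by simp)) ha ht).continuousWithinAt
  | succ n ih =>
    have hd {t : ℝ} (ht : t ∈ Ici (0 : ℝ)) :=
      hasDerivWithinAt_integral_cpow_smul_comp_mul (hf.of_le (by simp)) ha ht
    push_cast
    refine (contDiffOn_succ_iff_derivWithin (uniqueDiffOn_Ici 0)).2
      ⟨fun t ht => (hd ht).differentiableWithinAt, by simp, ?_⟩
    refine (ih (a := a + 1) ((contDiffOn_infty_iff_derivWithin (uniqueDiffOn_Ici 0)).1 hf).2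
      (by simp; linarith)).congr fun t ht => ?_
    exact (hd ht).derivWithin (uniqueDiffOn_Ici 0 t ht)

/-- The weighted average `t ↦ ∫₀¹ uᵃ f(tu) du` solves the Euler equation
`t ψ' + (a + 1) ψ = f`. -/
lemma smul_integral_add_smul_integral_eq {f : ℝ → V} (hf : ContDiffOn ℝ 1 f (Ici 0))
    {a : ℂ} (ha : -1 < a.re) {t : ℝ} (ht : 0 ≤ t) :
    (t : ℂ) • (∫ u in (0 : ℝ)..1, (u : ℂ) ^ (a + 1) • derivWithin f (Ici 0) (t * u)) +
      (a + 1) • (∫ u in (0 : ℝ)..1, (u : ℂ) ^ a • f (t * u)) = f t := by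
  have ha' : 0 < (a + 1).re := by simp; linarith
  have ha0 : a + 1 ≠ 0 := fun h => by simp [h] at ha'
  have hd : ContinuousOn (derivWithin f (Ici 0)) (Ici 0) :=
    hf.continuousOn_derivWithin (uniqueDiffOn_Ici 0) le_rfl
  have hmaps : MapsTo (fun u => t * u) (Icc 0 1) (Ici 0) := fun u hu => mul_nonneg ht hu.1
  have h1 := (intervalIntegrable_cpow_smul_comp_mul hd (a := a + 1) (by linarith) ht).smul (t : ℂ)
  have h2 := (intervalIntegrable_cpow_smul_comp_mul hf.continuousOn ha ht).smul (a + 1)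
  have hD : ∀ u ∈ Ioo (0 : ℝ) 1, HasDerivWithinAt (fun v : ℝ => (v : ℂ) ^ (a + 1) • f (t * v))
      ((t : ℂ) • ((u : ℂ) ^ (a + 1) • derivWithin f (Ici 0) (t * u)) +
        (a + 1) • ((u : ℂ) ^ a • f (t * u))) (Ioi u) u := by
    intro u hu
    have hc := (hasDerivAt_ofReal_cpow_const hu.1.ne' ha0).hasDerivWithinAt (s := Ioi u)
    have hfu := (hasDerivWithinAt_comp_mul_left hf ht hu.1.le).mono
      (Ioi_subset_Ici_self.trans (Ici_subset_Ici.2 hu.1.le))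
    refine (hc.smul hfu).congr_deriv ?_
    rw [add_sub_cancel_right, smul_comm (t : ℂ), mul_smul]
  rw [← intervalIntegral.integral_smul, ← intervalIntegral.integral_smul,
    ← intervalIntegral.integral_add (by exact h1) (by exact h2),
    intervalIntegral.integral_eq_sub_of_hasDeriv_right_of_le zero_le_one ?_ hD (h1.add h2)]
  · simp [Complex.zero_cpow ha0]
  · exact (Complex.continuous_ofReal_cpow_const ha').continuousOn.smul
      (hf.continuousOn.comp (by fun_prop) hmaps)

lemma exists_eq_add_smul_of_contDiffOn_Ici {f : ℝ → V}
    (hf : ContDiffOn ℝ (⊤ : ℕ∞) f (Ici 0)) :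
    ∃ g : ℝ → V, ContDiffOn ℝ (⊤ : ℕ∞) g (Ici 0) ∧ ∀ t, 0 ≤ t → f t = f 0 + (t : ℂ) • g t := by
  have hf1 : ContDiffOn ℝ 1 f (Ici 0) := hf.of_le (by simp)
  have hd := ((contDiffOn_infty_iff_derivWithin (uniqueDiffOn_Ici 0)).1 hf).2
  refine ⟨_, contDiffOn_integral_cpow_smul_comp_mul hd (a := 0) (by simp), fun t ht => ?_⟩
  have h1 := (intervalIntegrable_cpow_smul_comp_mul hd.continuousOn (a := 0) (by simp) ht).smul
    (t : ℂ)
  have hmaps : MapsTo (fun u => t * u) (Icc 0 1) (Ici 0) := fun u hu => mul_nonneg ht hu.1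
  rw [← intervalIntegral.integral_smul,
    intervalIntegral.integral_eq_sub_of_hasDeriv_right_of_le (f := fun u => f (t * u))
      (f' := fun u : ℝ => (t : ℂ) • ((u : ℂ) ^ (0 : ℂ) • derivWithin f (Ici 0) (t * u))) zero_le_one
      (hf.continuousOn.comp (by fun_prop) hmaps) (fun u hu => ?_) h1]
  · simp
  · refine ((hasDerivWithinAt_comp_mul_left hf1 ht hu.1.le).mono
      (Ioi_subset_Ici_self.trans (Ici_subset_Ici.2 hu.1.le))).congr_deriv ?_
    simp

/-- The inhomogeneous Euler equation `t ψ' - k ψ = f` has a solution smooth up to `0`, after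
removing from `f` a multiple of the resonant term `t ^ k` when `k` is a natural number. -/
lemma exists_contDiffOn_euler_solution {f : ℝ → V} (hf : ContDiffOn ℝ (⊤ : ℕ∞) f (Ici 0))
    (k : ℂ) :
    ∃ ψ : ℝ → V, ∃ c : V, ContDiffOn ℝ (⊤ : ℕ∞) ψ (Ici 0) ∧
      (∀ t : ℝ, 0 ≤ t →
        (t : ℂ) • derivWithin ψ (Ici 0) t - k • ψ t = f t - (t : ℂ) ^ k • c) ∧
      ((∀ n : ℕ, k ≠ n) → c = 0) := by
  obtain ⟨m, hm⟩ := exists_nat_gt k.re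
  induction m generalizing f k with
  | zero =>
    have ha : -1 < (-k - 1).re := by simpa using hm
    have hf1 : ContDiffOn ℝ 1 f (Ici 0) := hf.of_le (by simp)
    refine ⟨_, 0, contDiffOn_integral_cpow_smul_comp_mul hf ha, fun t ht => ?_, fun _ => rfl⟩
    rw [(hasDerivWithinAt_integral_cpow_smul_comp_mul hf1 ha ht).derivWithin
      (uniqueDiffOn_Ici 0 t ht)]
    have := smul_integral_add_smul_integral_eq hf1 ha ht
    rw [smul_zero, sub_zero, ← this, sub_add_cancel, neg_smul, sub_eq_add_neg]
  | succ m ih =>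
    obtain ⟨g, hg, hfg⟩ := exists_eq_add_smul_of_contDiffOn_Ici hf
    obtain ⟨χ, c, hχ, hode, hc⟩ := ih hg (k - 1) (by push_cast at hm; simp; linarith)
    have hψ (b : V) : ContDiffOn ℝ (⊤ : ℕ∞) (fun t : ℝ => (t : ℂ) • χ t + b) (Ici 0) :=
      (Complex.ofRealCLM.contDiff.contDiffOn.smul hχ).add contDiffOn_const
    have hderiv (b : V) (t : ℝ) (ht : 0 ≤ t) :
        derivWithin (fun t : ℝ => (t : ℂ) • χ t + b) (Ici 0) t =
          (t : ℂ) • derivWithin χ (Ici 0) t + χ t := by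
      have h1 := (hχ.differentiableOn (by simp) t ht).hasDerivWithinAt
      have h2 : HasDerivWithinAt (fun t : ℝ => (t : ℂ)) 1 (Ici 0) t :=
        Complex.ofRealCLM.hasDerivWithinAt
      simpa using ((h2.smul h1).add_const b).derivWithin (uniqueDiffOn_Ici 0 t ht)
    have key (b : V) (t : ℝ) (ht : 0 ≤ t) :
        (t : ℂ) • derivWithin (fun t : ℝ => (t : ℂ) • χ t + b) (Ici 0) t
          - k • ((t : ℂ) • χ t + b) =
          f t - f 0 - k • b - ((t : ℂ) * (t : ℂ) ^ (k - 1)) • c := by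
      rw [hderiv b t ht, hfg t ht]
      have := congrArg (fun v => (t : ℂ) • v) (hode t ht)
      simp only [smul_sub] at this
      rw [mul_smul, add_sub_cancel_left, sub_right_comm, ← this]
      module
    by_cases hk : k = 0
    · subst hk
      have hc0 : c = 0 := hc fun n hn => by
        have := congrArg Complex.re hn
        simp at this
        have : (0 : ℝ) ≤ n := n.cast_nonneg
        linarith
      refine ⟨_, f 0, hψ 0, fun t ht => ?_, fun h => absurd (h 0) (by simp)⟩
      rw [key 0 t ht, hc0]
      simp
    · refine ⟨_, c, hψ (-(k⁻¹ • f 0)), fun t ht => ?_, fun h => hc fun n hn => ?_⟩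
      · rw [key _ t ht, smul_neg, smul_inv_smul₀ hk, sub_neg_eq_add, sub_add_cancel]
        rcases eq_or_ne t 0 with rfl | ht0
        · simp [Complex.zero_cpow hk]
        · have ht0' := Complex.ofReal_ne_zero.2 ht0
          rw [Complex.cpow_sub _ _ ht0', Complex.cpow_one, mul_div_cancel₀ _ ht0']
      · exact h (n + 1) (by push_cast; rw [← hn]; ring)

end WeightedDilation

/-- For any `k ∈ ℂ` and `φ` smooth satisfying `(C_k)`, there exist a smooth
`ψ : ℝ≥0 → V` and `c ∈ V` with
`φ(λ, t) = λ^{-k} • ψ(λ t) − ψ(t) + t^k log(λ) • c`; moreover `c = 0` unless `k ∈ ℤ≥0`. -/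
theorem stmt7 {V : Type*} [NormedAddCommGroup V] [NormedSpace ℂ V]
    [FiniteDimensional ℂ V] (k : ℂ) (φ : ℝ → ℝ → V)
    (hsmooth : ContDiffOn ℝ (⊤ : ℕ∞) (fun p : ℝ × ℝ => φ p.1 p.2) (Ioi 0 ×ˢ Ici 0))
    (hcoc : ∀ l₁ > (0 : ℝ), ∀ l₂ > (0 : ℝ), ∀ t ≥ (0 : ℝ),
      φ (l₁ * l₂) t = ((l₂ : ℂ) ^ (-k)) • φ l₁ (t * l₂) + φ l₂ t) :
    ∃ ψ : ℝ → V, ∃ c : V, ContDiffOn ℝ (⊤ : ℕ∞) ψ (Ici 0) ∧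
      (∀ l > (0 : ℝ), ∀ t ≥ (0 : ℝ),
        φ l t = ((l : ℂ) ^ (-k)) • ψ (l * t) - ψ t
          + (((t : ℂ) ^ k) * (Real.log l : ℂ)) • c) ∧
      ((∀ n : ℕ, k ≠ (n : ℂ)) → c = 0) := by
  have : CompleteSpace V := FiniteDimensional.complete ℂ V
  set S : Set (ℝ × ℝ) := Ioi 0 ×ˢ Ici 0
  have hSu : UniqueDiffOn ℝ S := (uniqueDiffOn_Ioi 0).prod (uniqueDiffOn_Ici 0)
  let f : ℝ → V := fun t => fderivWithin ℝ (fun p : ℝ × ℝ => φ p.1 p.2) S (1, t) (1, 0)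
  have hmem {t : ℝ} (ht : 0 ≤ t) : ((1, t) : ℝ × ℝ) ∈ S := ⟨one_pos (α := ℝ), ht⟩
  have hf : ContDiffOn ℝ (⊤ : ℕ∞) f (Ici 0) :=
    ((hsmooth.fderivWithin hSu (by simp)).comp (t := S)
      (f := fun t : ℝ => ((1, t) : ℝ × ℝ)) (by fun_prop) fun t ht => hmem ht).clm_apply
      contDiffOn_const
  have hφ1 (t : ℝ) (ht : 0 ≤ t) : HasDerivAt (fun l => φ l t) (f t) 1 := by
    have h1 := (hsmooth.differentiableOn (by simp) _ (hmem ht)).hasFDerivWithinAt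
    have h2 : HasDerivWithinAt (fun l : ℝ => (l, t)) ((1, 0) : ℝ × ℝ) (Ioi 0) 1 :=
      ((hasDerivAt_id (1 : ℝ)).prodMk (hasDerivAt_const 1 t)).hasDerivWithinAt
    have hmaps : MapsTo (fun l : ℝ => (l, t)) (Ioi 0) S := fun l hl => ⟨hl, ht⟩
    exact (h1.comp_hasDerivWithinAt 1 h2 hmaps).hasDerivAt (Ioi_mem_nhds one_pos)
  have hφ (l t : ℝ) (hl : 0 < l) (ht : 0 ≤ t) :
      HasDerivAt (fun l => φ l t) (((l : ℂ) ^ (-k) * (l : ℂ)⁻¹) • f (l * t)) l := by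
    have h1 : HasDerivAt (fun x => φ x (t * l)) (f (t * l)) (l / l) := by
      rw [div_self hl.ne']
      exact hφ1 _ (mul_nonneg ht hl.le)
    have h2 := ((h1.scomp (h := fun x => x / l) l ((hasDerivAt_id l).div_const l)).const_smul
      ((l : ℂ) ^ (-k))).add_const (φ l t)
    refine (h2.congr_of_eventuallyEq ?_).congr_deriv ?_
    · filter_upwards [Ioi_mem_nhds hl] with x hx
      have := hcoc (x / l) (div_pos hx hl) l hl t ht
      rwa [div_mul_cancel₀ _ hl.ne'] at this
    · rw [mul_smul, mul_comm t l, one_div, ← Complex.ofReal_inv, Complex.coe_smul]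
  obtain ⟨ψ, c, hψ, hode, hc⟩ := exists_contDiffOn_euler_solution hf k
  refine ⟨ψ, c, hψ, fun l hl t ht => ?_, hc⟩
  have hderiv (x : ℝ) (hx : 0 < x) : HasDerivAt (fun x : ℝ => φ x t -
      (((x : ℂ) ^ (-k)) • ψ (x * t) - ψ t + (((t : ℂ) ^ k) * (Real.log x : ℂ)) • c)) 0 x := by
    have hx0 : (x : ℂ) ≠ 0 := Complex.ofReal_ne_zero.2 hx.ne'
    have hpow : HasDerivAt (fun x : ℝ => (x : ℂ) ^ (-k)) (-k * ((x : ℂ) ^ (-k) * (x : ℂ)⁻¹)) x := by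
      rcases eq_or_ne k 0 with rfl | hk
      · simpa using hasDerivAt_const x (1 : ℂ)
      · have := hasDerivAt_ofReal_cpow_const hx.ne' (neg_ne_zero.2 hk)
        rwa [Complex.cpow_sub _ _ hx0, Complex.cpow_one, div_eq_mul_inv] at this
    have hlog := (((Real.hasDerivAt_log hx.ne').ofReal_comp.const_mul ((t : ℂ) ^ k)).smul_const c)
    have hψx := (hasDerivWithinAt_comp_mul_left (hψ.of_le (by simp)) ht hx.le).hasDerivAt
      (Ici_mem_nhds hx)
    simp only [mul_comm t] at hψx
    refine ((hφ x t hx ht).sub (((hpow.smul hψx).sub_const (ψ t)).add hlog)).congr_deriv ?_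
    have hode' := hode (x * t) (mul_nonneg hx.le ht)
    rw [eq_sub_iff_add_eq] at hode'
    rw [← hode', Complex.ofReal_mul, Complex.mul_cpow_ofReal_nonneg hx.le ht, Complex.cpow_neg]
    have hxk : (x : ℂ) ^ k ≠ 0 := by simp [Complex.cpow_eq_zero_iff, hx0]
    push_cast
    match_scalars <;> field_simp <;> ring
  have hφ_one : φ 1 t = 0 := by simpa using hcoc 1 one_pos 1 one_pos t ht
  have := isOpen_Ioi.is_const_of_deriv_eq_zero isPreconnected_Ioi
    (fun x hx => (hderiv x hx).differentiableAt.differentiableWithinAt)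
    (fun x hx => (hderiv x hx).deriv) (mem_Ioi.2 hl) (mem_Ioi.2 one_pos)
  simpa [hφ_one, sub_eq_zero] using this
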